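/- For all smooth functions F, H on ℝ^(2n+1), the Jacobi–Lie bracket of the contact Hamiltonian vector fields satisfies [X^c_F, X^c_H] = −X^c_{{F,H}^c}; thus the space of contact Hamiltonian vector fields is a Lie subalgebra of the contact vector fields and H ↦ X^c_H is a Lie algebra isomorphism from (C^∞, {·,·}^c) onto the contact Hamiltonian vector fields equipped with minus the Jacobi–Lie bracket. -/

import Mathlib

noncomputable section

/-- The contact phase space `ℝ^(2n+1)` with coordinates `(q, p, z)`. -/
abbrev Nc (n : ℕ) : Type := (Fin n → ℝ) × (Fin n → ℝ) × ℝ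

/-- Coordinate direction `∂/∂qⁱ`. -/
def eQ (n : ℕ) (i : Fin n) : Nc n := (Pi.single i 1, 0, 0)

/-- Coordinate direction `∂/∂pᵢ`. -/
def eP (n : ℕ) (i : Fin n) : Nc n := (0, Pi.single i 1, 0)

/-- Coordinate direction `∂/∂z` (the Reeb field). -/
def eZ (n : ℕ) : Nc n := (0, 0, 1)

/-- Partial derivative of `F` in the direction `v`. -/
def pd {n : ℕ} (F : Nc n → ℝ) (v : Nc n) (x : Nc n) : ℝ := fderiv ℝ F x v

/-- The contact (Jacobi) bracket. -/
def cBracket {n : ℕ} (F H : Nc n → ℝ) : Nc n → ℝ :=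
  fun x => (∑ i, (pd F (eQ n i) x * pd H (eP n i) x - pd F (eP n i) x * pd H (eQ n i) x))
    + (F x - ∑ i, x.2.1 i * pd F (eP n i) x) * pd H (eZ n) x
    - (H x - ∑ i, x.2.1 i * pd H (eP n i) x) * pd F (eZ n) x

/-- The contact Hamiltonian vector field `X^c_H`: `qⁱ`-component `∂H/∂pᵢ`,
`pᵢ`-component `−(∂H/∂qⁱ + pᵢ ∂H/∂z)`, `z`-component `Σᵢ pᵢ ∂H/∂pᵢ − H`. -/
def Xc {n : ℕ} (H : Nc n → ℝ) : Nc n → Nc n :=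
  fun x => (fun i => pd H (eP n i) x,
            fun i => - (pd H (eQ n i) x + x.2.1 i * pd H (eZ n) x),
            (∑ i, x.2.1 i * pd H (eP n i) x) - H x)

/-- The Jacobi–Lie bracket of vector fields:
`[X,Y]ᵏ = Σⱼ (Xʲ ∂Yᵏ/∂xʲ − Yʲ ∂Xᵏ/∂xʲ)`, i.e. `[X,Y] = DY·X − DX·Y`. -/
def jlb {E : Type*} [NormedAddCommGroup E] [NormedSpace ℝ E] (X Y : E → E) : E → E :=
  fun x => fderiv ℝ Y x (X x) - fderiv ℝ X x (Y x)

lemma two_le_smooth : (2 : WithTop ℕ∞) ≤ ((⊤ : ℕ∞) : WithTop ℕ∞) :=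
  WithTop.coe_le_coe.2 (le_top : ((2 : ℕ∞)) ≤ ⊤)

lemma pd_diff {n : ℕ} {F : Nc n → ℝ} (hF : ContDiff ℝ (⊤ : ℕ∞) F) (v : Nc n) :
    Differentiable ℝ (pd F v) := by
  have h1 : ContDiff ℝ 1 (fderiv ℝ F) := hF.fderiv_right (by rw [one_add_one_eq_two]; exact two_le_smooth)
  have h2 : ContDiff ℝ 1 (fun x => fderiv ℝ F x v) := h1.clm_apply contDiff_const
  exact h2.differentiable one_ne_zero

lemma pd_symm {n : ℕ} {F : Nc n → ℝ} (hF : ContDiff ℝ (⊤ : ℕ∞) F) (v w x : Nc n) :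
    pd (pd F v) w x = pd (pd F w) v x := by
  have h1 : ContDiff ℝ 1 (fderiv ℝ F) := hF.fderiv_right (by rw [one_add_one_eq_two]; exact two_le_smooth)
  have h3 : DifferentiableAt ℝ (fderiv ℝ F) x := h1.differentiable one_ne_zero x
  have key : ∀ a b : Nc n, pd (pd F a) b x = fderiv ℝ (fderiv ℝ F) x b a := by
    intro a b
    have : HasFDerivAt (pd F a) _ x := h3.hasFDerivAt.clm_apply (hasFDerivAt_const a x)
    unfold pd at this ⊢
    rw [this.fderiv]
    simp
  rw [key, key]
  have hs : IsSymmSndFDerivAt ℝ F x := hF.contDiffAt.isSymmSndFDerivAt (by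
    simp only [minSmoothness_of_isRCLikeNormedField]; exact two_le_smooth)
  exact hs w v

lemma pd_decomp {n : ℕ} (F : Nc n → ℝ) (v x : Nc n) :
    pd F v x = (∑ i, v.1 i * pd F (eQ n i) x) + (∑ i, v.2.1 i * pd F (eP n i) x)
      + v.2.2 * pd F (eZ n) x := by
  have hv : v = (∑ i, v.1 i • eQ n i) + (∑ i, v.2.1 i • eP n i) + v.2.2 • eZ n := by
    refine Prod.ext ?_ (Prod.ext ?_ ?_)
    · ext j
      simp [eQ, eP, eZ, Prod.fst_sum, Finset.sum_apply, Pi.single_apply]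
    · ext j
      simp [eQ, eP, eZ, Prod.fst_sum, Prod.snd_sum, Finset.sum_apply, Pi.single_apply]
    · simp [eQ, eP, eZ, Prod.snd_sum]
  unfold pd
  conv_lhs => rw [hv]
  simp only [map_add, map_sum, map_smul, smul_eq_mul]

lemma hasD {n : ℕ} {F : Nc n → ℝ} (hF : Differentiable ℝ F) (x v : Nc n) :
    HasDerivAt (fun t : ℝ => F (x + t • v)) (pd F v x) 0 := by
  have h := (hF (x + (0:ℝ) • v)).hasFDerivAt.comp_hasDerivAt (0:ℝ)
    (((hasDerivAt_id (0:ℝ)).smul_const v).const_add x)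
  simpa [pd, Function.comp_def] using h

lemma hasP {n : ℕ} (x v : Nc n) (i : Fin n) :
    HasDerivAt (fun t : ℝ => (x + t • v).2.1 i) (v.2.1 i) 0 := by
  have := ((hasDerivAt_id (0:ℝ)).mul_const (v.2.1 i)).const_add (x.2.1 i)
  simpa using this

lemma pd_eq_of {n : ℕ} {G : Nc n → ℝ} (hG : Differentiable ℝ G) {x v : Nc n} {c : ℝ}
    (h : HasDerivAt (fun t : ℝ => G (x + t • v)) c 0) : pd G v x = c :=
  (hasD hG x v).unique h

lemma P_diff {n : ℕ} (i : Fin n) : Differentiable ℝ (fun x : Nc n => x.2.1 i) := by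
  fun_prop

lemma K_diff {n : ℕ} {F H : Nc n → ℝ}
    (hF : ContDiff ℝ (⊤ : ℕ∞) F) (hH : ContDiff ℝ (⊤ : ℕ∞) H) :
    Differentiable ℝ (cBracket F H) := by
  have a := pd_diff hF
  have b := pd_diff hH
  have c : Differentiable ℝ F := hF.differentiable (by simp)
  have d : Differentiable ℝ H := hH.differentiable (by simp)
  unfold cBracket
  fun_prop

lemma pd_K {n : ℕ} {F H : Nc n → ℝ}
    (hF : ContDiff ℝ (⊤ : ℕ∞) F) (hH : ContDiff ℝ (⊤ : ℕ∞) H) (x v : Nc n) :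
    pd (cBracket F H) v x = pd (pd F v) (Xc H x) x - pd (pd H v) (Xc F x) x
      + (pd F v x - ∑ i, v.2.1 i * pd F (eP n i) x) * pd H (eZ n) x
      - (pd H v x - ∑ i, v.2.1 i * pd H (eP n i) x) * pd F (eZ n) x := by
  have a := fun w => hasD (pd_diff hF w) x v
  have b := fun w => hasD (pd_diff hH w) x v
  have c := hasD (hF.differentiable (by simp)) x v
  have d := hasD (hH.differentiable (by simp)) x v
  have key := ((HasDerivAt.fun_sum (u := Finset.univ) (fun i _ =>
      ((a (eQ n i)).fun_mul (b (eP n i))).fun_sub ((a (eP n i)).fun_mul (b (eQ n i))))).fun_add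
    ((c.fun_sub (HasDerivAt.fun_sum (u := Finset.univ) (fun i _ =>
      (hasP x v i).fun_mul (a (eP n i))))).fun_mul (b (eZ n)))).fun_sub
    ((d.fun_sub (HasDerivAt.fun_sum (u := Finset.univ) (fun i _ =>
      (hasP x v i).fun_mul (b (eP n i))))).fun_mul (a (eZ n)))
  rw [pd_eq_of (K_diff hF hH) key]
  rw [pd_decomp (pd F v) (Xc H x), pd_decomp (pd H v) (Xc F x)]
  simp only [pd_symm hF v, pd_symm hH v, Xc, zero_smul, add_zero]
  simp only [neg_mul, add_mul, sub_mul, Finset.sum_add_distrib,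
    Finset.sum_sub_distrib, Finset.sum_neg_distrib, Finset.sum_mul, neg_add]
  simp only [mul_comm, mul_left_comm, mul_assoc]
  ring

lemma Xc_diff {n : ℕ} {H : Nc n → ℝ} (hH : ContDiff ℝ (⊤ : ℕ∞) H) :
    Differentiable ℝ (Xc H) := by
  have b := pd_diff hH
  have d : Differentiable ℝ H := hH.differentiable (by simp)
  unfold Xc
  fun_prop

lemma fderiv_Xc {n : ℕ} {H : Nc n → ℝ} (hH : ContDiff ℝ (⊤ : ℕ∞) H) (x v : Nc n) :
    fderiv ℝ (Xc H) x v = (fun i => pd (pd H (eP n i)) v x,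
      fun i => -(pd (pd H (eQ n i)) v x
        + (v.2.1 i * pd H (eZ n) x + x.2.1 i * pd (pd H (eZ n)) v x)),
      (∑ i, (v.2.1 i * pd H (eP n i) x + x.2.1 i * pd (pd H (eP n i)) v x)) - pd H v x) := by
  have b := fun w => hasD (pd_diff hH w) x v
  have d := hasD (hH.differentiable (by simp)) x v
  have h := (Xc_diff hH (x + (0:ℝ) • v)).hasFDerivAt.comp_hasDerivAt (0:ℝ)
    (((hasDerivAt_id (0:ℝ)).smul_const v).const_add x)
  have k := (hasDerivAt_pi.2 (fun i => b (eP n i))).prodMk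
    ((hasDerivAt_pi.2 (fun i => ((b (eQ n i)).fun_add
      ((hasP x v i).fun_mul (b (eZ n)))).fun_neg)).prodMk
    ((HasDerivAt.fun_sum (u := Finset.univ) (fun i _ =>
      (hasP x v i).fun_mul (b (eP n i)))).fun_sub d))
  have := h.unique k
  simpa using this

theorem contact_hamiltonian_antihomomorphism (n : ℕ) (F H : Nc n → ℝ)
    (hF : ContDiff ℝ (⊤ : ℕ∞) F) (hH : ContDiff ℝ (⊤ : ℕ∞) H) :
    ∀ x, jlb (Xc F) (Xc H) x = - Xc (cBracket F H) x := by
  intro x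
  have kP : ∀ i, pd (cBracket F H) (eP n i) x
      = pd (pd F (eP n i)) (Xc H x) x - pd (pd H (eP n i)) (Xc F x) x := by
    intro i
    rw [pd_K hF hH]
    simp [eP, Pi.single_apply]
  have kQ : ∀ i, pd (cBracket F H) (eQ n i) x
      = pd (pd F (eQ n i)) (Xc H x) x - pd (pd H (eQ n i)) (Xc F x) x
        + pd F (eQ n i) x * pd H (eZ n) x - pd H (eQ n i) x * pd F (eZ n) x := by
    intro i
    rw [pd_K hF hH]
    simp [eQ]
  have kZ : pd (cBracket F H) (eZ n) x
      = pd (pd F (eZ n)) (Xc H x) x - pd (pd H (eZ n)) (Xc F x) x := by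
    rw [pd_K hF hH]
    simp [eZ]
    ring
  unfold jlb
  rw [fderiv_Xc hF, fderiv_Xc hH]
  refine Prod.ext ?_ (Prod.ext ?_ ?_)
  · ext i
    have : (Xc (cBracket F H) x).1 i = pd (cBracket F H) (eP n i) x := rfl
    simp only [Prod.fst_sub, Prod.fst_neg, Pi.sub_apply, Pi.neg_apply, this, kP]
    ring
  · ext i
    have h0 : (Xc (cBracket F H) x).2.1 i = -(pd (cBracket F H) (eQ n i) x
      + x.2.1 i * pd (cBracket F H) (eZ n) x) := rfl
    have h1 : (Xc F x).2.1 i = -(pd F (eQ n i) x + x.2.1 i * pd F (eZ n) x) := rfl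
    have h2 : (Xc H x).2.1 i = -(pd H (eQ n i) x + x.2.1 i * pd H (eZ n) x) := rfl
    simp only [Prod.fst_sub, Prod.fst_neg, Prod.snd_sub, Prod.snd_neg, Pi.sub_apply,
      Pi.neg_apply, h0, h1, h2, kQ, kZ]
    ring
  · have h0 : (Xc (cBracket F H) x).2.2 = (∑ i, x.2.1 i * pd (cBracket F H) (eP n i) x)
      - cBracket F H x := rfl
    have h1 : ∀ i, (Xc F x).2.1 i = -(pd F (eQ n i) x + x.2.1 i * pd F (eZ n) x) :=
      fun _ => rfl
    have h2 : ∀ i, (Xc H x).2.1 i = -(pd H (eQ n i) x + x.2.1 i * pd H (eZ n) x) :=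
      fun _ => rfl
    have e1 : pd F (Xc H x) x = _ := pd_decomp F (Xc H x) x
    have e2 : pd H (Xc F x) x = _ := pd_decomp H (Xc F x) x
    have h3 : ∀ i, (Xc F x).1 i = pd F (eP n i) x := fun _ => rfl
    have h4 : ∀ i, (Xc H x).1 i = pd H (eP n i) x := fun _ => rfl
    have h5 : (Xc F x).2.2 = (∑ i, x.2.1 i * pd F (eP n i) x) - F x := rfl
    have h6 : (Xc H x).2.2 = (∑ i, x.2.1 i * pd H (eP n i) x) - H x := rfl
    simp only [Prod.snd_sub, Prod.snd_neg, h0, kP, e1, e2, h1, h2, h3, h4, h5, h6, cBracket]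
    simp only [neg_mul, add_mul, sub_mul, mul_sub, Finset.sum_add_distrib,
      Finset.sum_sub_distrib, Finset.sum_neg_distrib, Finset.sum_mul, neg_add]
    simp only [mul_comm, mul_left_comm, mul_assoc]
    ring
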